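/- Let R > 0 with ΛR² < 1 and set α₀ := (2Λ/3)R²/(1−ΛR²). Suppose the first-order system holds on the segment {u}×[v₁,v₂] (with 0 < v₁ < v₂) together with the non-trapped region hypotheses and 0 < r ≤ R there. Define η(u) := 2(ϖ(u,v₂) − ϖ(u,v₁))/r(u,v₂) and δ(u) := (r(u,v₂) − r(u,v₁))/r(u,v₁). Then ( ζ(u,v₂) − ζ(u,v₁) )² ≤ e^{α₀} · η(u) · δ(u) · ν(u,v₂) · κ̄(u,v₂). -/

import Mathlib

open Set

/-- Partial derivative with respect to the first (ingoing, `u`) variable. -/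
noncomputable def pdu (f : ℝ × ℝ → ℝ) (p : ℝ × ℝ) : ℝ := deriv (fun s => f (s, p.2)) p.1

/-- Partial derivative with respect to the second (outgoing, `v`) variable. -/
noncomputable def pdv (f : ℝ × ℝ → ℝ) (p : ℝ × ℝ) : ℝ := deriv (fun t => f (p.1, t)) p.2

/-- `1 - μ = 1 - 2ϖ/r - (Λ/3) r²`. -/
noncomputable def oneMinusMu (Λ : ℝ) (r ϖ : ℝ × ℝ → ℝ) (p : ℝ × ℝ) : ℝ :=
  1 - 2 * ϖ p / r p - Λ / 3 * (r p) ^ 2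

/-- `∂_r (1 - μ) = 2ϖ/r² - (2Λ/3) r`. -/
noncomputable def drOneMinusMu (Λ : ℝ) (r ϖ : ℝ × ℝ → ℝ) (p : ℝ × ℝ) : ℝ :=
  2 * ϖ p / (r p) ^ 2 - 2 * Λ / 3 * r p

/-- The first-order double-null Einstein–scalar field system with cosmological
constant `Λ`, at the point `p`, for the area radius `r`, renormalized Hawking
mass `ϖ`, scalar field derivatives `θ = r ∂_v φ`, `ζ = r ∂_u φ`, and the
quantities `κ`, `κb` (`κ̄`); here `λ := ∂_v r` and `ν := ∂_u r`. -/
def FirstOrderSystem (Λ : ℝ) (r ϖ θ ζ κ κb : ℝ × ℝ → ℝ) (p : ℝ × ℝ) : Prop :=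
  pdu (pdv r) p = pdv r p * pdu r p * drOneMinusMu Λ r ϖ p / oneMinusMu Λ r ϖ p ∧
  pdv (pdu r) p = pdv r p * pdu r p * drOneMinusMu Λ r ϖ p / oneMinusMu Λ r ϖ p ∧
  pdu ϖ p = (ζ p) ^ 2 / (2 * κb p) ∧
  pdv ϖ p = (θ p) ^ 2 / (2 * κ p) ∧
  pdu θ p = -(ζ p * pdv r p) / r p ∧
  pdv ζ p = -(θ p * pdu r p) / r p ∧
  pdv κb p = κb p * (θ p) ^ 2 / (r p * pdv r p) ∧
  pdu κ p = κ p * (ζ p) ^ 2 / (r p * pdu r p) ∧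
  pdu r p = κb p * oneMinusMu Λ r ϖ p ∧
  pdv r p = κ p * oneMinusMu Λ r ϖ p

/-- Non-trapped region hypotheses: `λ > 0`, `ν < 0`, `κ > 0`, `κ̄ < 0`,
`ϖ ≥ 0` and `0 < 1 - μ ≤ 1`. -/
def NonTrappedAt (Λ : ℝ) (r ϖ κ κb : ℝ × ℝ → ℝ) (p : ℝ × ℝ) : Prop :=
  0 < pdv r p ∧ pdu r p < 0 ∧ 0 < κ p ∧ κb p < 0 ∧ 0 ≤ ϖ p ∧
  0 < oneMinusMu Λ r ϖ p ∧ oneMinusMu Λ r ϖ p ≤ 1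

theorem core1d (Λ R : ℝ) (hΛ : 0 < Λ) (hR : 0 < R) (hΛR : Λ * R ^ 2 < 1)
    (r w θ ζ κ κb l n : ℝ → ℝ) (v₁ v₂ : ℝ) (h12 : v₁ < v₂)
    (dr : ∀ v ∈ Icc v₁ v₂, HasDerivAt r (l v) v)
    (dw : ∀ v ∈ Icc v₁ v₂, HasDerivAt w ((θ v) ^ 2 / (2 * κ v)) v)
    (dz : ∀ v ∈ Icc v₁ v₂, HasDerivAt ζ (-(θ v * n v) / r v) v)
    (dk : ∀ v ∈ Icc v₁ v₂, HasDerivAt κb (κb v * (θ v) ^ 2 / (r v * l v)) v)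
    (hn : ∀ v ∈ Icc v₁ v₂, n v = κb v * (1 - 2 * w v / r v - Λ / 3 * (r v) ^ 2))
    (hl : ∀ v ∈ Icc v₁ v₂, l v = κ v * (1 - 2 * w v / r v - Λ / 3 * (r v) ^ 2))
    (hκ : ∀ v ∈ Icc v₁ v₂, 0 < κ v) (hw : ∀ v ∈ Icc v₁ v₂, 0 ≤ w v)
    (hm : ∀ v ∈ Icc v₁ v₂, 0 < 1 - 2 * w v / r v - Λ / 3 * (r v) ^ 2)
    (hr : ∀ v ∈ Icc v₁ v₂, 0 < r v ∧ r v ≤ R) :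
    (ζ v₂ - ζ v₁) ^ 2 ≤
      Real.exp (2 * Λ / 3 * R ^ 2 / (1 - Λ * R ^ 2)) *
        (2 * (w v₂ - w v₁) / r v₂) * ((r v₂ - r v₁) / r v₁) * n v₂ * κb v₂ := by
  have h1 : v₁ ∈ Icc v₁ v₂ := ⟨le_rfl, h12.le⟩
  have h2 : v₂ ∈ Icc v₁ v₂ := ⟨h12.le, le_rfl⟩
  have hpos : 0 < 1 - Λ * R ^ 2 := by linarith
  obtain ⟨c, hc⟩ : ∃ c, c = 2 * Λ / 3 * R / (1 - Λ * R ^ 2) := ⟨_, rfl⟩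
  have hc0 : 0 ≤ c := by rw [hc]; positivity
  have hcm : c * (1 - Λ * R ^ 2) = 2 * Λ / 3 * R := by rw [hc]; field_simp
  have hcR : 2 * Λ / 3 * R ^ 2 / (1 - Λ * R ^ 2) = c * R := by rw [hc]; ring
  have dG : ∀ v ∈ Icc v₁ v₂, HasDerivAt
      (fun v => Real.exp (c * r v) * (κb v ^ 2 * (1 - 2 * w v / r v - Λ / 3 * (r v) ^ 2)))
      (Real.exp (c * r v) * κb v ^ 2 * ((θ v) ^ 2 / (r v * κ v) +
        l v * ((2 * w v / (r v) ^ 2 - 2 * Λ / 3 * r v)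
          + c * (1 - 2 * w v / r v - Λ / 3 * (r v) ^ 2)))) v := by
    intro v hv
    have hrv := (hr v hv).1
    have hkv := hκ v hv
    have hmv := hm v hv
    have hlv := hl v hv
    have e := (((dr v hv).const_mul c).exp).mul (((dk v hv).pow 2).mul
      ((((((dw v hv).const_mul 2).div (dr v hv) hrv.ne').const_sub 1)).sub
        (((dr v hv).pow 2).const_mul (Λ / 3))))
    refine e.congr_deriv ?_
    simp only [Pi.mul_apply, Pi.pow_apply, Pi.sub_apply, Pi.div_apply]
    obtain ⟨m, hmd⟩ : ∃ m, m = 1 - 2 * w v / r v - Λ / 3 * (r v) ^ 2 := ⟨_, rfl⟩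
    rw [← hmd] at hmv hlv ⊢
    rw [hlv]
    field_simp
    ring
  have hG : MonotoneOn
      (fun v => Real.exp (c * r v) * (κb v ^ 2 * (1 - 2 * w v / r v - Λ / 3 * (r v) ^ 2)))
      (Icc v₁ v₂) := by
    refine monotoneOn_of_deriv_nonneg (convex_Icc _ _)
      (fun v hv => (dG v hv).continuousAt.continuousWithinAt)
      (fun v hv => (dG v (interior_subset hv)).differentiableAt.differentiableWithinAt) ?_
    intro v hv
    have hv := interior_subset hv
    rw [(dG v hv).deriv]
    obtain ⟨hrv, hrR⟩ := hr v hv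
    have hkv := hκ v hv
    have hmv := hm v hv
    have hlv : 0 ≤ l v := by rw [hl v hv]; positivity
    have hwv := hw v hv
    have key : 0 ≤ (2 * w v / (r v) ^ 2 - 2 * Λ / 3 * r v)
          + c * (1 - 2 * w v / r v - Λ / 3 * (r v) ^ 2) := by
      have hx : 2 * w v / (r v) ^ 2 = (2 * w v / r v) / r v := by field_simp
      have hx0 : 0 ≤ 2 * w v / r v := by positivity
      rw [hx]
      obtain ⟨x, hxd⟩ : ∃ x, x = 2 * w v / r v := ⟨_, rfl⟩
      rw [← hxd] at hx0 hmv ⊢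
      by_cases h : 0 ≤ x / r v - 2 * Λ / 3 * r v
      · have := mul_nonneg hc0 hmv.le
        linarith
      · push Not at h
        have h' : x < 2 * Λ / 3 * r v * r v := by
          rw [← div_lt_iff₀ hrv]; linarith
        have hsq : r v ^ 2 ≤ R ^ 2 := by gcongr
        have h3 : 1 - Λ * R ^ 2 ≤ 1 - x - Λ / 3 * r v ^ 2 := by nlinarith
        have h4 := mul_le_mul_of_nonneg_left h3 hc0
        have h5 : 2 * Λ / 3 * r v ≤ 2 * Λ / 3 * R := by gcongr
        have h6 : 0 ≤ x / r v := by positivity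
        linarith
    positivity
  obtain ⟨K, hK⟩ : ∃ K, K = Real.exp (c * R) *
    (κb v₂ ^ 2 * (1 - 2 * w v₂ / r v₂ - Λ / 3 * (r v₂) ^ 2)) := ⟨_, rfl⟩
  have hbd : ∀ v ∈ Icc v₁ v₂, κb v ^ 2 * (1 - 2 * w v / r v - Λ / 3 * (r v) ^ 2) ≤ K := by
    intro v hv
    have h := hG hv h2 hv.2
    simp only at h
    have hm2 := hm v₂ h2
    have hmv := hm v hv
    have a1 : (1:ℝ) ≤ Real.exp (c * r v) :=
      Real.one_le_exp (mul_nonneg hc0 (hr v hv).1.le)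
    have a2 : Real.exp (c * r v₂) ≤ Real.exp (c * R) :=
      Real.exp_le_exp.2 (mul_le_mul_of_nonneg_left (hr v₂ h2).2 hc0)
    calc _ ≤ Real.exp (c * r v) * (κb v ^ 2 * (1 - 2 * w v / r v - Λ / 3 * (r v) ^ 2)) :=
          le_mul_of_one_le_left (by positivity) a1
      _ ≤ _ := h
      _ ≤ K := by rw [hK]; exact mul_le_mul_of_nonneg_right a2 (by positivity)
  have quad : ∀ t : ℝ, 0 ≤ (w v₂ - w v₁) * (t * t) + (-2 * (ζ v₂ - ζ v₁)) * t
      + 2 * K * ((r v₁)⁻¹ - (r v₂)⁻¹) := by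
    intro t
    have dH : ∀ v ∈ Icc v₁ v₂, HasDerivAt
        (fun v => t ^ 2 * w v - 2 * K * (r v)⁻¹ - 2 * t * ζ v)
        (t ^ 2 * ((θ v) ^ 2 / (2 * κ v)) - 2 * K * (-(l v) / (r v) ^ 2)
          - 2 * t * (-(θ v * n v) / r v)) v := fun v hv =>
      (((dw v hv).const_mul _).sub (((dr v hv).inv (hr v hv).1.ne').const_mul _)).sub
        ((dz v hv).const_mul _)
    have hH : MonotoneOn (fun v => t ^ 2 * w v - 2 * K * (r v)⁻¹ - 2 * t * ζ v)
        (Icc v₁ v₂) := by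
      refine monotoneOn_of_deriv_nonneg (convex_Icc _ _)
        (fun v hv => (dH v hv).continuousAt.continuousWithinAt)
        (fun v hv => (dH v (interior_subset hv)).differentiableAt.differentiableWithinAt) ?_
      intro v hv
      have hv := interior_subset hv
      rw [(dH v hv).deriv]
      obtain ⟨hrv, hrR⟩ := hr v hv
      have hkv := hκ v hv
      have hmv := hm v hv
      have hb := hbd v hv
      rw [hl v hv, hn v hv]
      obtain ⟨m, hmd⟩ : ∃ m, m = 1 - 2 * w v / r v - Λ / 3 * (r v) ^ 2 := ⟨_, rfl⟩
      rw [← hmd] at hmv hb ⊢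
      have e : t ^ 2 * ((θ v) ^ 2 / (2 * κ v)) - 2 * K * (-(κ v * m) / (r v) ^ 2)
          - 2 * t * (-(θ v * (κb v * m)) / r v)
          = (t * θ v + 2 * κ v * (κb v * m) / r v) ^ 2 / (2 * κ v)
            + 2 * (K - κb v ^ 2 * m) * (κ v * m) / (r v) ^ 2 := by
        field_simp
        ring
      rw [e]
      have : 0 ≤ K - κb v ^ 2 * m := by linarith
      positivity
    have h := hH h1 h2 h12.le
    simp only at h
    linarith
  have hd := discrim_le_zero quad
  unfold discrim at hd
  have hr1 := (hr v₁ h1).1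
  have hr2 := (hr v₂ h2).1
  rw [hcR]
  have fin : Real.exp (c * R) *
        (2 * (w v₂ - w v₁) / r v₂) * ((r v₂ - r v₁) / r v₁) * n v₂ * κb v₂
      = (w v₂ - w v₁) * (2 * K * ((r v₁)⁻¹ - (r v₂)⁻¹)) := by
    rw [hK, hn v₂ h2]
    obtain ⟨m, hmd⟩ : ∃ m, m = 1 - 2 * w v₂ / r v₂ - Λ / 3 * (r v₂) ^ 2 := ⟨_, rfl⟩
    rw [← hmd]
    field_simp
  rw [fin]
  nlinarith

theorem hasDeriv_slice (f : ℝ × ℝ → ℝ) (O : Set (ℝ × ℝ)) (hO : IsOpen O)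
    (hf : ContDiffOn ℝ (⊤ : ℕ∞) f O) (u v : ℝ) (h : (u, v) ∈ O) :
    HasDerivAt (fun t => f (u, t)) (pdv f (u, v)) v := by
  have h1 : DifferentiableAt ℝ f (u, v) :=
    (hf.contDiffAt (hO.mem_nhds h)).differentiableAt (by simp)
  have h2 : DifferentiableAt ℝ (fun t : ℝ => f (u, t)) v :=
    DifferentiableAt.comp (g := f) (f := fun t : ℝ => (u, t)) v h1 (by fun_prop)
  exact h2.hasDerivAt

theorem stmt8 (Λ R : ℝ) (hΛ : 0 < Λ) (hR : 0 < R) (hΛR : Λ * R ^ 2 < 1)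
    (r ϖ θ ζ κ κb : ℝ × ℝ → ℝ) (u v₁ v₂ : ℝ) (hv₁ : 0 < v₁) (hv₁₂ : v₁ < v₂)
    (O : Set (ℝ × ℝ)) (hO : IsOpen O) (hSO : ({u} : Set ℝ) ×ˢ Icc v₁ v₂ ⊆ O)
    (hr : ContDiffOn ℝ (⊤ : ℕ∞) r O) (hϖ : ContDiffOn ℝ (⊤ : ℕ∞) ϖ O)
    (hθ : ContDiffOn ℝ (⊤ : ℕ∞) θ O) (hζ : ContDiffOn ℝ (⊤ : ℕ∞) ζ O)
    (hκ : ContDiffOn ℝ (⊤ : ℕ∞) κ O) (hκb : ContDiffOn ℝ (⊤ : ℕ∞) κb O)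
    (hsys : ∀ p ∈ ({u} : Set ℝ) ×ˢ Icc v₁ v₂, FirstOrderSystem Λ r ϖ θ ζ κ κb p)
    (hnt : ∀ p ∈ ({u} : Set ℝ) ×ˢ Icc v₁ v₂, NonTrappedAt Λ r ϖ κ κb p)
    (hrbd : ∀ p ∈ ({u} : Set ℝ) ×ˢ Icc v₁ v₂, 0 < r p ∧ r p ≤ R) :
    (ζ (u, v₂) - ζ (u, v₁)) ^ 2 ≤
      Real.exp (2 * Λ / 3 * R ^ 2 / (1 - Λ * R ^ 2)) *
        (2 * (ϖ (u, v₂) - ϖ (u, v₁)) / r (u, v₂)) *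
        ((r (u, v₂) - r (u, v₁)) / r (u, v₁)) *
        pdu r (u, v₂) * κb (u, v₂) := by
  have mem : ∀ v ∈ Icc v₁ v₂, (u, v) ∈ ({u} : Set ℝ) ×ˢ Icc v₁ v₂ := fun v hv => ⟨rfl, hv⟩
  refine core1d Λ R hΛ hR hΛR (fun v => r (u, v)) (fun v => ϖ (u, v)) (fun v => θ (u, v))
    (fun v => ζ (u, v)) (fun v => κ (u, v)) (fun v => κb (u, v)) (fun v => pdv r (u, v))
    (fun v => pdu r (u, v)) v₁ v₂ hv₁₂ ?_ ?_ ?_ ?_ ?_ ?_ ?_ ?_ ?_ ?_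
  all_goals
    intro v hv
    have hm := mem v hv
    obtain ⟨-, -, -, s4, -, s6, s7, -, s9, s10⟩ := hsys _ hm
    obtain ⟨n1, n2, n3, n4, n5, n6, n7⟩ := hnt _ hm
  · exact hasDeriv_slice r O hO hr u v (hSO hm)
  · exact (hasDeriv_slice ϖ O hO hϖ u v (hSO hm)).congr_deriv s4
  · exact (hasDeriv_slice ζ O hO hζ u v (hSO hm)).congr_deriv s6
  · exact (hasDeriv_slice κb O hO hκb u v (hSO hm)).congr_deriv s7
  · exact s9
  · exact s10
  · exact n3
  · exact n5
  · exact n6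
  · exact hrbd _ hm
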